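/- arXiv:0908.1162 — 5 statements merged into one kernel-verified Lean document; each statement's English description precedes it below -/
import Mathlib

section
/- Let C₁, …, C_{2k} ∈ ℝ^{p×q} be real matrices satisfying the Hurwitz–Radon conditions C_iᵀC_j + C_jᵀC_i = 0 for all i ≠ j. Then for every h ∈ ℝ^q, the Gram–Schmidt vectors u₁, …, u_{2k} of the family of columns c_i = C_i h satisfy u_i = c_i for every i, and in particular ⟨u_i, c_j⟩ = 0 for all i ≠ j; that is, the block R₁,₁ of the R matrix in the Q-R decomposition of the lattice generator is diagonal. -/
open Matrix RealInnerProductSpace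

/-- `Fin n` is well-founded with respect to the `<` coming from its lattice structure
(needed for `gramSchmidt` to elaborate on a `Fin`-indexed family). -/
instance finWellFoundedLT (n : ℕ) :
    @WellFoundedLT (Fin n)
      (@Preorder.toLT _ (@PartialOrder.toPreorder _ (@SemilatticeInf.toPartialOrder _
        (@Lattice.toSemilatticeInf _ (@DistribLattice.toLattice _
          (@instDistribLatticeOfLinearOrder _ (@Fin.instLinearOrder n))))))) :=
  @IsWellOrder.toIsWellFounded (Fin n) (· < ·) (Fin.Lt.isWellOrder n)

/-- If `C₁, …, C_{2k}` satisfy the Hurwitz–Radon conditions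
`C_iᵀC_j + C_jᵀC_i = 0` for `i ≠ j`, then for every `h ∈ ℝ^q` the Gram–Schmidt
vectors `u_i` of the family of columns `c_i = C_i h` satisfy `u_i = c_i` for every `i`,
and in particular `⟨u_i, c_j⟩ = 0` for all `i ≠ j`; that is, the block `R₁,₁` of the
R matrix in the Q-R decomposition of the lattice generator is diagonal. -/
theorem gramSchmidt_fixed_of_hurwitz_radon (k p q : ℕ) (hk : 0 < k)
    (C : Fin (2 * k) → Matrix (Fin p) (Fin q) ℝ)
    (hHR : ∀ i j : Fin (2 * k), i ≠ j → (C i)ᵀ * C j + (C j)ᵀ * C i = 0)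
    (h : Fin q → ℝ) :
    ∀ c : Fin (2 * k) → EuclideanSpace ℝ (Fin p),
      (c = fun t => (WithLp.equiv 2 (Fin p → ℝ)).symm ((C t).mulVec h)) →
      (∀ i, InnerProductSpace.gramSchmidt ℝ c i = c i) ∧
        (∀ i j : Fin (2 * k), i ≠ j → ⟪InnerProductSpace.gramSchmidt ℝ c i, c j⟫ = 0) := by
  intro c hc
  have key : ∀ i j : Fin (2 * k), i ≠ j → ⟪c i, c j⟫ = 0 := by
    intro i j hij
    have e : ∀ a b : Fin (2 * k), ⟪c a, c b⟫ = h ⬝ᵥ (((C a)ᵀ * C b) *ᵥ h) := by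
      intro a b
      have h1 : ⟪c a, c b⟫ = ((C a) *ᵥ h) ⬝ᵥ ((C b) *ᵥ h) := by
        subst hc
        simp [PiLp.inner_apply, dotProduct, mul_comm]
      rw [h1, ← Matrix.mulVec_mulVec, Matrix.dotProduct_mulVec h, Matrix.vecMul_transpose]
    have h2 : ⟪c i, c j⟫ + ⟪c j, c i⟫ = 0 := by
      rw [e, e, ← dotProduct_add, ← Matrix.add_mulVec, hHR i j hij]
      simp
    have h3 : ⟪c j, c i⟫ = ⟪c i, c j⟫ := real_inner_comm _ _
    linarith
  have hg : InnerProductSpace.gramSchmidt ℝ c = c :=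
    InnerProductSpace.gramSchmidt_of_orthogonal ℝ (fun i j hij => key i j hij)
  rw [hg]
  exact ⟨fun _ => rfl, key⟩
end

section
/- Let k ≥ 1 and let c₁, …, c_{4k} be vectors in ℝ^p such that: (i) c₁, …, c_{2k} are pairwise orthogonal and all have the same nonzero norm; (ii) c_{2k+1}, …, c_{4k} are pairwise orthogonal; (iii) for all distinct l, m ∈ {2k+1, …, 4k}, Σ_{j=1}^{2k} ⟨c_j, c_l⟩⟨c_j, c_m⟩ = 0. Then the Gram–Schmidt vectors u₁, …, u_{4k} of the family satisfy ⟨u_l, c_m⟩ = 0 for all distinct l, m ∈ {2k+1, …, 4k}; that is, the block R₂,₂ of the R matrix is diagonal. -/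
open Matrix RealInnerProductSpace

/-- sufficiency, core of the 'if' direction of Theorem 1: if the first `2k`
vectors are pairwise orthogonal with common nonzero norm, the last `2k` vectors are pairwise
orthogonal, and `Σ_{j=1}^{2k} ⟨c_j, c_l⟩⟨c_j, c_m⟩ = 0` for distinct `l, m` among the last
`2k` indices, then the Gram–Schmidt vectors satisfy `⟨u_l, c_m⟩ = 0` for all such `l ≠ m`;
i.e. the block `R₂,₂` of the R matrix is diagonal. -/
theorem gramSchmidt_inner_eq_zero_of_sum_condition (k p : ℕ) (hk : 1 ≤ k)
    (c : Fin (4 * k) → EuclideanSpace ℝ (Fin p)) (r : ℝ) (hr : r ≠ 0)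
    (horth₁ : ∀ i j : Fin (4 * k), (i : ℕ) < 2 * k → (j : ℕ) < 2 * k → i ≠ j →
      ⟪c i, c j⟫ = 0)
    (hnorm : ∀ i : Fin (4 * k), (i : ℕ) < 2 * k → ‖c i‖ = r)
    (horth₂ : ∀ i j : Fin (4 * k), 2 * k ≤ (i : ℕ) → 2 * k ≤ (j : ℕ) → i ≠ j →
      ⟪c i, c j⟫ = 0)
    (hsum : ∀ l m : Fin (4 * k), 2 * k ≤ (l : ℕ) → 2 * k ≤ (m : ℕ) → l ≠ m →
      ∑ j ∈ Finset.univ.filter (fun j : Fin (4 * k) => (j : ℕ) < 2 * k),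
        ⟪c j, c l⟫ * ⟪c j, c m⟫ = 0) :
    ∀ l m : Fin (4 * k), 2 * k ≤ (l : ℕ) → 2 * k ≤ (m : ℕ) → l ≠ m →
      ⟪InnerProductSpace.gramSchmidt ℝ c l, c m⟫ = 0 := by
  have hfirst : ∀ n : ℕ, ∀ i : Fin (4 * k), (i : ℕ) = n → (i : ℕ) < 2 * k →
      InnerProductSpace.gramSchmidt ℝ c i = c i := by
    intro n
    induction n using Nat.strong_induction_on with
    | _ n ih =>
      intro i hin hi
      rw [InnerProductSpace.gramSchmidt_def, Finset.sum_eq_zero, sub_zero]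
      intro j hj
      have hji : j < i := Finset.mem_Iio.1 hj
      have hji' : (j : ℕ) < i := hji
      rw [ih j (by omega) j rfl (by omega), Submodule.starProjection_singleton,
        horth₁ j i (by omega) hi hji.ne]
      simp
  have main : ∀ n : ℕ, ∀ l : Fin (4 * k), (l : ℕ) = n → 2 * k ≤ (l : ℕ) →
      ∀ m : Fin (4 * k), 2 * k ≤ (m : ℕ) → l ≠ m →
      ⟪InnerProductSpace.gramSchmidt ℝ c l, c m⟫ = 0 := by
    intro n
    induction n using Nat.strong_induction_on with
    | _ n ih =>
      intro l hln hl m hm hlm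
      rw [InnerProductSpace.gramSchmidt_def, inner_sub_left, horth₂ l m hl hm hlm, sum_inner,
        zero_sub, neg_eq_zero]
      have hs := hsum l m hl hm hlm
      have hsub : Finset.univ.filter (fun j : Fin (4 * k) => (j : ℕ) < 2 * k) ⊆
          Finset.Iio l := by
        intro j hj
        have hj' : (j : ℕ) < 2 * k := (Finset.mem_filter.1 hj).2
        exact Finset.mem_Iio.2 (Fin.lt_def.2 (by omega))
      rw [← Finset.sum_subset hsub]
      · rw [← mul_zero (r ^ 2)⁻¹, ← hs, Finset.mul_sum]
        refine Finset.sum_congr rfl fun j hj => ?_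
        have hj' : (j : ℕ) < 2 * k := (Finset.mem_filter.1 hj).2
        rw [hfirst j j rfl hj', Submodule.starProjection_singleton, real_inner_smul_left,
          hnorm j hj']
        simp only [RCLike.ofReal_real_eq_id, id]
        ring
      · intro j hj hj2
        have hjl : j < l := Finset.mem_Iio.1 hj
        have hjl' : (j : ℕ) < l := hjl
        have hj' : 2 * k ≤ (j : ℕ) := by
          by_contra h
          exact hj2 (Finset.mem_filter.2 ⟨Finset.mem_univ _, by omega⟩)
        rw [Submodule.starProjection_singleton, ih j (by omega) j rfl hj' l hl hjl.ne]
        simp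
  intro l m hl hm hlm
  exact main l l rfl hl m hm hlm
end

section
/- Let k ≥ 1 and let c₁, …, c_{4k} be vectors in ℝ^p such that: (i) c₁, …, c_{2k} are pairwise orthogonal and all have the same nonzero norm; (ii) c_{2k+1}, …, c_{4k} are pairwise orthogonal; (iii) the Gram–Schmidt vectors u₁, …, u_{4k} of the family satisfy ⟨u_l, c_m⟩ = 0 for all distinct l, m ∈ {2k+1, …, 4k}. Then Σ_{j=1}^{2k} ⟨c_j, c_l⟩⟨c_j, c_m⟩ = 0 for all distinct l, m ∈ {2k+1, …, 4k}. -/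
open Matrix RealInnerProductSpace

/-- necessity, core of the 'only if' direction of Theorem 1: if the first `2k`
vectors are pairwise orthogonal with common nonzero norm, the last `2k` vectors are pairwise
orthogonal, and the Gram–Schmidt vectors satisfy `⟨u_l, c_m⟩ = 0` for all distinct `l, m`
among the last `2k` indices (i.e. the block `R₂,₂` is diagonal), then
`Σ_{j=1}^{2k} ⟨c_j, c_l⟩⟨c_j, c_m⟩ = 0` for all such `l ≠ m`. -/
theorem sum_condition_of_gramSchmidt_inner_eq_zero (k p : ℕ) (hk : 1 ≤ k)
    (c : Fin (4 * k) → EuclideanSpace ℝ (Fin p)) (r : ℝ) (hr : r ≠ 0)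
    (horth₁ : ∀ i j : Fin (4 * k), (i : ℕ) < 2 * k → (j : ℕ) < 2 * k → i ≠ j →
      ⟪c i, c j⟫ = 0)
    (hnorm : ∀ i : Fin (4 * k), (i : ℕ) < 2 * k → ‖c i‖ = r)
    (horth₂ : ∀ i j : Fin (4 * k), 2 * k ≤ (i : ℕ) → 2 * k ≤ (j : ℕ) → i ≠ j →
      ⟪c i, c j⟫ = 0)
    (hgs : ∀ l m : Fin (4 * k), 2 * k ≤ (l : ℕ) → 2 * k ≤ (m : ℕ) → l ≠ m →
      ⟪InnerProductSpace.gramSchmidt ℝ c l, c m⟫ = 0) :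
    ∀ l m : Fin (4 * k), 2 * k ≤ (l : ℕ) → 2 * k ≤ (m : ℕ) → l ≠ m →
      ∑ j ∈ Finset.univ.filter (fun j : Fin (4 * k) => (j : ℕ) < 2 * k),
        ⟪c j, c l⟫ * ⟪c j, c m⟫ = 0 := by
  have hu : ∀ n : ℕ, ∀ i : Fin (4 * k), (i : ℕ) = n → (i : ℕ) < 2 * k →
      InnerProductSpace.gramSchmidt ℝ c i = c i := by
    intro n
    induction n using Nat.strong_induction_on with
    | _ n ih =>
      intro i hin hi
      have h := InnerProductSpace.gramSchmidt_def'' ℝ c i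
      rw [Finset.sum_eq_zero, add_zero] at h
      · exact h.symm
      · intro j hj
        have hji : j < i := Finset.mem_Iio.1 hj
        have hji' : (j : ℕ) < (i : ℕ) := hji
        rw [ih j (by omega) j rfl (by omega), horth₁ j i (by omega) hi hji.ne]
        simp
  intro l m hl hm hlm
  have h := congrArg (fun x => ⟪x, c m⟫) (InnerProductSpace.gramSchmidt_def'' ℝ c l)
  simp only [inner_add_left, sum_inner, inner_smul_left] at h
  rw [horth₂ l m hl hm hlm, hgs l m hl hm hlm, zero_add] at h
  have hsub : Finset.univ.filter (fun j : Fin (4 * k) => (j : ℕ) < 2 * k) ⊆ Finset.Iio l := by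
    intro j hj
    have hj' : (j : ℕ) < 2 * k := by simpa using hj
    exact Finset.mem_Iio.2 (Fin.lt_def.2 (by omega))
  rw [← Finset.sum_subset hsub] at h
  · have h2 : ∑ j ∈ Finset.univ.filter (fun j : Fin (4 * k) => (j : ℕ) < 2 * k),
        ⟪c j, c l⟫ * ⟪c j, c m⟫ / r ^ 2 = 0 := by
      rw [h]
      refine Finset.sum_congr rfl fun j hj => ?_
      have hj' : (j : ℕ) < 2 * k := by simpa using hj
      rw [hu j j rfl hj', hnorm j hj']
      simp
      ring
    rw [← Finset.sum_div] at h2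
    exact (div_eq_zero_iff.1 h2).resolve_right (pow_ne_zero 2 hr)
  · intro j hj hj2
    have hj' : 2 * k ≤ (j : ℕ) := by simpa using hj2
    rw [hgs j l hj' hl (Finset.mem_Iio.1 hj).ne]
    simp
end

section
/- Let k ≥ 1 and let C₁, …, C_{2k} ∈ ℝ^{p×q} satisfy: (a) C_iᵀ C_i = I_q for every i; (b) C_iᵀ C_j + C_jᵀ C_i = 0 for all i ≠ j; (c) for every pair of distinct indices l, m ∈ {1, …, 2k} there is a partition of {1, …, 2k} into k two-element groups G_i^{l,m} = {g_i(1), g_i(2)} with C_lᵀ C_{g_i(1)} = C_mᵀ C_{g_i(2)} and C_mᵀ C_{g_i(1)} = −C_lᵀ C_{g_i(2)} for all i. Then for all h⁽¹⁾, h⁽²⁾ ∈ ℝ^q, defining the 4k vectors c_i = C_i h⁽¹⁾ for 1 ≤ i ≤ 2k and c_{2k+i} = C_i h⁽²⁾ for 1 ≤ i ≤ 2k, the Gram–Schmidt vectors u₁, …, u_{4k} of this family satisfy ⟨u_i, c_j⟩ = 0 whenever i ≠ j with both i, j ∈ {1,…,2k}, and whenever i ≠ j with both i, j ∈ {2k+1,…,4k}.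 -/
open Matrix RealInnerProductSpace

theorem inner_mulVec_mulVec {p q : ℕ} (A B : Matrix (Fin p) (Fin q) ℝ) (x y : Fin q → ℝ) :
    ⟪(WithLp.equiv 2 (Fin p → ℝ)).symm (A *ᵥ x), (WithLp.equiv 2 (Fin p → ℝ)).symm (B *ᵥ y)⟫
      = x ⬝ᵥ ((Aᵀ * B) *ᵥ y) := by
  have h : ⟪(WithLp.equiv 2 (Fin p → ℝ)).symm (A *ᵥ x),
      (WithLp.equiv 2 (Fin p → ℝ)).symm (B *ᵥ y)⟫ = (A *ᵥ x) ⬝ᵥ (B *ᵥ y) := by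
    simp [PiLp.inner_apply, dotProduct, mul_comm]
  rw [h, ← Matrix.mulVec_mulVec, Matrix.dotProduct_mulVec, Matrix.dotProduct_mulVec,
    Matrix.vecMul_transpose, ← Matrix.dotProduct_mulVec]

theorem skew_quad {p q : ℕ} (A B : Matrix (Fin p) (Fin q) ℝ) (h : Aᵀ * B + Bᵀ * A = 0)
    (x : Fin q → ℝ) : x ⬝ᵥ ((Aᵀ * B) *ᵥ x) = 0 := by
  have h1 : x ⬝ᵥ ((Aᵀ * B) *ᵥ x) = x ⬝ᵥ ((Bᵀ * A) *ᵥ x) := by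
    rw [← inner_mulVec_mulVec, ← inner_mulVec_mulVec, real_inner_comm]
  have h2 : x ⬝ᵥ ((Aᵀ * B + Bᵀ * A) *ᵥ x) = 0 := by rw [h]; simp
  rw [Matrix.add_mulVec, dotProduct_add] at h2
  linarith

theorem inner_gs {n : ℕ} {E : Type*} [NormedAddCommGroup E] [InnerProductSpace ℝ E]
    (c : Fin n → E) (i : Fin n) (v : E) :
    ⟪InnerProductSpace.gramSchmidt ℝ c i, v⟫ = ⟪c i, v⟫ - ∑ j ∈ Finset.Iio i,
      ⟪InnerProductSpace.gramSchmidt ℝ c j, c i⟫ * ⟪InnerProductSpace.gramSchmidt ℝ c j, v⟫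
        / ‖InnerProductSpace.gramSchmidt ℝ c j‖ ^ 2 := by
  conv_lhs => rw [InnerProductSpace.gramSchmidt_def]
  rw [inner_sub_left, sum_inner]
  congr 1
  refine Finset.sum_congr rfl fun j _ => ?_
  rw [Submodule.starProjection_singleton, inner_smul_left]
  simp
  ring

/-- 'if' direction of Theorem 1: under (a) `C_iᵀC_i = I`, (b) the
Hurwitz–Radon conditions, and (c) the k-group-partition conditions for every pair of
distinct indices, for all channel vectors `h⁽¹⁾, h⁽²⁾` the Gram–Schmidt vectors of the
family `c_i = C_i h⁽¹⁾` (`i ≤ 2k`), `c_{2k+i} = C_i h⁽²⁾` satisfy `⟨u_i, c_j⟩ = 0` for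
distinct `i, j` both in the first block or both in the second block; i.e. the blocks
`R₁,₁` and `R₂,₂` of the R matrix are both diagonal. -/
theorem gramSchmidt_diag_blocks_of_conditions (k p q : ℕ) (hk : 1 ≤ k)
    (C : Fin (2 * k) → Matrix (Fin p) (Fin q) ℝ)
    (ha : ∀ i : Fin (2 * k), (C i)ᵀ * C i = 1)
    (hb : ∀ i j : Fin (2 * k), i ≠ j → (C i)ᵀ * C j + (C j)ᵀ * C i = 0)
    (hc : ∀ l m : Fin (2 * k), l ≠ m →
      ∃ g : Fin k → Fin (2 * k) × Fin (2 * k),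
        Function.Bijective
          (fun x : Fin k × Bool => if x.2 then (g x.1).1 else (g x.1).2) ∧
        ∀ i : Fin k,
          (C l)ᵀ * C ((g i).1) = (C m)ᵀ * C ((g i).2) ∧
          (C m)ᵀ * C ((g i).1) = -((C l)ᵀ * C ((g i).2)))
    (h₁ h₂ : Fin q → ℝ) :
    ∀ c : Fin (4 * k) → EuclideanSpace ℝ (Fin p),
      (∀ (i : Fin (4 * k)) (hi : (i : ℕ) < 2 * k),
        c i = (WithLp.equiv 2 (Fin p → ℝ)).symm ((C ⟨(i : ℕ), hi⟩).mulVec h₁)) →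
      (∀ (i : Fin (4 * k)) (hi : 2 * k ≤ (i : ℕ)),
        c i = (WithLp.equiv 2 (Fin p → ℝ)).symm
          ((C ⟨(i : ℕ) - 2 * k, by have := i.isLt; omega⟩).mulVec h₂)) →
      ∀ i j : Fin (4 * k), i ≠ j →
        (((i : ℕ) < 2 * k ∧ (j : ℕ) < 2 * k) ∨
          (2 * k ≤ (i : ℕ) ∧ 2 * k ≤ (j : ℕ))) →
        ⟪InnerProductSpace.gramSchmidt ℝ c i, c j⟫ = 0 := by
  intro c hc1 hc2
  have hle : 2 * k ≤ 4 * k := by omega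
  have key : ∀ i j : Fin (4 * k), i ≠ j →
      (((i : ℕ) < 2 * k ∧ (j : ℕ) < 2 * k) ∨ (2 * k ≤ (i : ℕ) ∧ 2 * k ≤ (j : ℕ))) →
      ⟪c i, c j⟫ = 0 := by
    rintro i j hij (⟨hi, hj⟩ | ⟨hi, hj⟩)
    · rw [hc1 i hi, hc1 j hj, inner_mulVec_mulVec]
      refine skew_quad _ _ (hb _ _ ?_) _
      intro h; apply hij; ext; simpa using h
    · rw [hc2 i hi, hc2 j hj, inner_mulVec_mulVec]
      refine skew_quad _ _ (hb _ _ ?_) _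
      intro h; apply hij; ext; simp at h; omega
  -- first block: the Gram-Schmidt vectors are the vectors themselves
  have first : ∀ i : Fin (4 * k), (i : ℕ) < 2 * k → InnerProductSpace.gramSchmidt ℝ c i = c i := by
    intro i
    induction i using WellFoundedLT.induction with
    | ind i ih =>
      intro hi
      rw [InnerProductSpace.gramSchmidt_def, Finset.sum_eq_zero, sub_zero]
      intro j hj
      have hj' : j < i := Finset.mem_Iio.mp hj
      have hj2 : (j : ℕ) < 2 * k := lt_trans hj' hi
      rw [Submodule.starProjection_singleton, ih j hj' hj2, key j i hj'.ne (Or.inl ⟨hj2, hi⟩)]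
      simp
  have hsum : ∀ l m : Fin (2 * k), l ≠ m →
      ∑ j, (h₂ ⬝ᵥ (((C l)ᵀ * C j) *ᵥ h₁)) * (h₂ ⬝ᵥ (((C m)ᵀ * C j) *ᵥ h₁)) = 0 := by
    intro l m hlm
    obtain ⟨g, hg, hg2⟩ := hc l m hlm
    rw [← hg.sum_comp, Fintype.sum_prod_type]
    refine Finset.sum_eq_zero fun i _ => ?_
    obtain ⟨e1, e2⟩ := hg2 i
    have e3 : (C l)ᵀ * C (g i).2 = -((C m)ᵀ * C (g i).1) := by rw [e2, neg_neg]
    simp only [Fintype.sum_bool, if_true, Bool.false_eq_true, if_false]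
    rw [e3, ← e1, Matrix.neg_mulVec, dotProduct_neg]
    ring
  intro i
  induction i using WellFoundedLT.induction with
  | ind i ih =>
    rintro j hij (hb1 | ⟨hi, hj⟩)
    · rw [first i hb1.1]; exact key i j hij (Or.inl hb1)
    · rw [inner_gs, key i j hij (Or.inr ⟨hi, hj⟩), zero_sub, neg_eq_zero]
      have hlm : (⟨(i : ℕ) - 2 * k, by have := i.isLt; omega⟩ : Fin (2 * k)) ≠
          ⟨(j : ℕ) - 2 * k, by have := j.isLt; omega⟩ := by
        intro h; apply hij; ext; simp at h; omega
      have hs := hsum _ _ hlm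
      have hs2 := congrArg (fun t => t / (h₁ ⬝ᵥ h₁)) hs
      simp only [zero_div, Finset.sum_div] at hs2
      rw [← hs2]
      symm
      refine Finset.sum_of_injOn (Fin.castLE hle) ?_ ?_ ?_ ?_
      · exact (Fin.castLE_injective hle).injOn
      · intro t _
        simp only [Finset.coe_Iio, Set.mem_Iio, Fin.lt_def, Fin.val_castLE]
        omega
      · intro t ht ht2
        have ht' : t < i := Finset.mem_Iio.mp ht
        have h2t : 2 * k ≤ (t : ℕ) := by
          by_contra hcon
          exact ht2 ⟨⟨t, by omega⟩, by simp, by ext; simp⟩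
        rw [ih t ht' i ht'.ne (Or.inr ⟨h2t, hi⟩)]
        simp
      · intro t _
        have htl : ((Fin.castLE hle t : Fin (4 * k)) : ℕ) < 2 * k := by simp
        have hn : ‖c (Fin.castLE hle t)‖ ^ 2 = h₁ ⬝ᵥ h₁ := by
          rw [← real_inner_self_eq_norm_sq, hc1 _ htl, inner_mulVec_mulVec, ha, Matrix.one_mulVec]
        rw [first _ htl, hn, real_inner_comm, real_inner_comm (c j), hc1 _ htl, hc2 i hi, hc2 j hj,
          inner_mulVec_mulVec, inner_mulVec_mulVec]
        simp
end

section
/- Let a, b be positive integers, set N_t = 2a and k = 2b, and let x₁, …, x_{2b} be complex numbers. For m = 0, 1, …, b−1 let Ω_m be the 2×2 Alamouti matrix with rows (x_{2m+1}, −x_{2m+2}*) and (x_{2m+2}, x_{2m+1}*), let X_m = Ω_m ⊗ I_a ∈ ℂ^{2a×2a} (the Kronecker product with the a×a identity), and let X ∈ ℂ^{2ab×2a} be the vertical stacking of X₀, X₁, …, X_{b−1}. Then Xᴴ X = (Σ_{i=1}^{2b} |x_i|²) · I_{2a}. -/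
open Matrix

theorem sum_fin_two_mul (b : ℕ) (f : Fin (2 * b) → ℝ) :
    ∑ i, f i = ∑ m : Fin b, (f ⟨2 * (m : ℕ), by have := m.isLt; omega⟩
      + f ⟨2 * (m : ℕ) + 1, by have := m.isLt; omega⟩) := by
  induction b with
  | zero => simp
  | succ n ih =>
    rw [Fin.sum_univ_castSucc (n := n)]
    have h := ih (fun i => f ⟨i, by have := i.isLt; omega⟩)
    simp only [Fin.val_castSucc, Fin.val_last]
    rw [← h]
    have h2 : ∑ i, f i = ∑ i : Fin (2 * n + 1 + 1), f i := rfl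
    rw [h2, Fin.sum_univ_castSucc, Fin.sum_univ_castSucc, add_assoc]
    rfl

/-- Case 1 design of Section IV: with `N_t = 2a`, `k = 2b`, Alamouti
blocks `Ω_m` in the variables `x_{2m+1}, x_{2m+2}`, `X_m = Ω_m ⊗ I_a`, and `X` the
vertical stacking of `X₀, …, X_{b−1}`, one has `Xᴴ X = (Σ_{i=1}^{2b} |x_i|²) I_{2a}`. -/
theorem case1_design_orthogonality (a b : ℕ) (ha : 0 < a) (hb : 0 < b)
    (x : Fin (2 * b) → ℂ)
    (Ω : Fin b → Matrix (Fin 2) (Fin 2) ℂ)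
    (hΩ : ∀ m : Fin b,
      Ω m = !![x ⟨2 * (m : ℕ), by have := m.isLt; omega⟩,
                -(starRingEnd ℂ) (x ⟨2 * (m : ℕ) + 1, by have := m.isLt; omega⟩);
               x ⟨2 * (m : ℕ) + 1, by have := m.isLt; omega⟩,
                (starRingEnd ℂ) (x ⟨2 * (m : ℕ), by have := m.isLt; omega⟩)])
    (Xm : Fin b → Matrix (Fin 2 × Fin a) (Fin 2 × Fin a) ℂ)
    (hXm : ∀ m : Fin b,
      Xm m = Matrix.kroneckerMap (· * ·) (Ω m) (1 : Matrix (Fin a) (Fin a) ℂ))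
    (X : Matrix (Fin b × (Fin 2 × Fin a)) (Fin 2 × Fin a) ℂ)
    (hX : ∀ (m : Fin b) (r c : Fin 2 × Fin a), X (m, r) c = Xm m r c) :
    Xᴴ * X = ((∑ i, ‖x i‖ ^ 2 : ℝ) : ℂ) • 1 := by
  rw [sum_fin_two_mul]
  have key : ∀ (m : Fin b), (Ω m)ᴴ * Ω m =
      ((‖x ⟨2 * (m : ℕ), by have := m.isLt; omega⟩‖ ^ 2
        + ‖x ⟨2 * (m : ℕ) + 1, by have := m.isLt; omega⟩‖ ^ 2 : ℝ) : ℂ) • 1 := by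
    intro m
    rw [hΩ m]
    ext i j
    fin_cases i <;> fin_cases j <;>
      simp [Matrix.mul_apply, Fin.sum_univ_two, ← Complex.mul_conj'] <;> ring
  have key2 : ∀ m : Fin b, (Xm m)ᴴ * Xm m =
      ((‖x ⟨2 * (m : ℕ), by have := m.isLt; omega⟩‖ ^ 2
        + ‖x ⟨2 * (m : ℕ) + 1, by have := m.isLt; omega⟩‖ ^ 2 : ℝ) : ℂ) • 1 := by
    intro m
    rw [hXm m]
    rw [Matrix.conjTranspose_kronecker, ← Matrix.mul_kronecker_mul, key m,
      Matrix.smul_kronecker, Matrix.conjTranspose_one, Matrix.one_mul,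
      Matrix.one_kronecker_one]
  have key3 : Xᴴ * X = ∑ m, (Xm m)ᴴ * Xm m := by
    ext c d
    rw [Matrix.sum_apply, Matrix.mul_apply, Fintype.sum_prod_type]
    refine Finset.sum_congr rfl fun m _ => ?_
    rw [Matrix.mul_apply]
    simp only [Matrix.conjTranspose_apply, hX]
  rw [key3, Finset.sum_congr rfl fun m _ => key2 m, ← Finset.sum_smul, Complex.ofReal_sum]
end
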